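/- Let M be a nonempty finite set of nonnegative real-valued functions on a finite set V with |V| ≥ 2, and let w ∈ V be such that for all m ∈ M, m(w) < (1/(|V|-1)) ∑_{v ≠ w} m(v). Then every supporting weight x̲^M (i.e., every weight maximizing x ↦ min_{m ∈ M} ∑_v x(v) m(v)) satisfies x̲^M(w) = 0. -/

import Mathlib

/-- The direction that moves mass from `w` evenly (with rate `c`) to the other points. -/
theorem sum_ite_neg_one_mul {V : Type*} [Fintype V] [DecidableEq V] (w : V) (c : ℝ) (g : V → ℝ) :
    ∑ v : V, (if v = w then -1 else c) * g v = c * ∑ v ∈ Finset.univ.erase w, g v - g w := by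
  rw [← Finset.add_sum_erase _ _ (Finset.mem_univ w), Finset.mul_sum]
  have h : ∑ v ∈ Finset.univ.erase w, (if v = w then -1 else c) * g v =
      ∑ v ∈ Finset.univ.erase w, c * g v :=
    Finset.sum_congr rfl fun v hv => by rw [if_neg (Finset.ne_of_mem_erase hv)]
  rw [h, if_pos rfl]
  ring

theorem supporting_weight_vanishes {V : Type*} [Fintype V] [DecidableEq V]
    (hV : 2 ≤ Fintype.card V)
    (M : Finset (V → ℝ)) (hM : M.Nonempty) (hpos : ∀ m ∈ M, ∀ v, 0 ≤ m v)
    (w : V)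
    (hw : ∀ m ∈ M, m w < (1 / ((Fintype.card V : ℝ) - 1)) *
      ∑ v ∈ Finset.univ.erase w, m v)
    (x : V → ℝ) (hx0 : ∀ v, 0 ≤ x v) (hx1 : ∑ v : V, x v = 1)
    (hsupp : ∀ y : V → ℝ, (∀ v, 0 ≤ y v) → (∑ v : V, y v = 1) →
      M.inf' hM (fun m => ∑ v : V, y v * m v) ≤
      M.inf' hM (fun m => ∑ v : V, x v * m v)) :
    x w = 0 := by
  by_contra hne
  have hxw : 0 < x w := lt_of_le_of_ne (hx0 w) (Ne.symm hne)
  have hn : (0 : ℝ) < (Fintype.card V : ℝ) - 1 := by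
    have : (2 : ℝ) ≤ Fintype.card V := by exact_mod_cast hV
    linarith
  set c : ℝ := 1 / ((Fintype.card V : ℝ) - 1) with hc
  have hc0 : 0 < c := by positivity
  have key (g : V → ℝ) : ∑ v : V, (x v + x w * (if v = w then -1 else c)) * g v =
      ∑ v : V, x v * g v + x w * (c * ∑ v ∈ Finset.univ.erase w, g v - g w) := by
    rw [← sum_ite_neg_one_mul, Finset.mul_sum, ← Finset.sum_add_distrib]
    exact Finset.sum_congr rfl fun v _ => by ring
  have hy0 (v : V) : 0 ≤ x v + x w * (if v = w then -1 else c) := by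
    split_ifs with h
    · subst h
      linarith
    · have := hx0 v
      positivity
  have hy1 : ∑ v : V, (x v + x w * (if v = w then -1 else c)) = 1 := by
    have hcard : c * ∑ _v ∈ Finset.univ.erase w, (1 : ℝ) = 1 := by
      rw [Finset.sum_const, Finset.card_erase_of_mem (Finset.mem_univ w), Finset.card_univ,
        nsmul_eq_mul, Nat.cast_sub (by omega), hc]
      push_cast
      field_simp
    have h := key fun _ => 1
    rw [hcard] at h
    simpa [hx1] using h
  refine (hsupp _ hy0 hy1).not_gt ?_
  rw [Finset.lt_inf'_iff]
  intro m hm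
  rw [key]
  calc M.inf' hM (fun m => ∑ v : V, x v * m v) ≤ ∑ v : V, x v * m v := Finset.inf'_le _ hm
    _ < _ := lt_add_of_pos_right _ (mul_pos hxw (sub_pos.2 (hw m hm)))
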